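/- Let (W,S) be a Coxeter system with Coxeter matrix M over an index set B. An element w ∈ W is fully commutative if and only if no reduced word for w contains, as a contiguous subword (List.IsInfix), the alternating word i, j, i, j, ... of length M i j for any pair i, j with M i j ≥ 3. -/

import Mathlib

/-- A *commutation move* on words over the index set `B` of a Coxeter matrix `M`:
replace a contiguous subword `[i, j]` by `[j, i]`, for indices `i, j` with `M i j = 2`. -/
def CommutationMoveRel {B : Type*} (M : CoxeterMatrix B) (ω ω' : List B) : Prop :=
  ∃ (i j : B) (l₁ l₂ : List B), M i j = 2 ∧
    ω = l₁ ++ [i, j] ++ l₂ ∧ ω' = l₁ ++ [j, i] ++ l₂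

/-- `w` is *fully commutative* if any two reduced words for `w` are related by a sequence
of commutation moves (i.e., `w` has a single commutation class). -/
def IsFullyCommutative {B : Type*} {W : Type*} [Group W] {M : CoxeterMatrix B}
    (cs : CoxeterSystem M W) (w : W) : Prop :=
  ∀ ω ω' : List B, cs.IsReduced ω → cs.IsReduced ω' →
    cs.wordProd ω = w → cs.wordProd ω' = w →
    Relation.ReflTransGen (CommutationMoveRel M) ω ω'

namespace CoxeterSystem

open Module Polynomial.Chebyshev

/-! ### The geometric representation and the order of a product of two simple reflections -/

section Geometric

variable {B : Type*} (M : CoxeterMatrix B)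

/-- The linear form `v ↦ 2 ⟪e i, v⟫` for the bilinear form of the geometric representation. -/
noncomputable def simpleCoroot (i : B) : Dual ℝ (B →₀ ℝ) :=
  Finsupp.linearCombination ℝ fun j ↦ -2 * Real.cos (Real.pi / M i j)

theorem simpleCoroot_single (i j : B) :
    simpleCoroot M i (Finsupp.single j 1) = -2 * Real.cos (Real.pi / M i j) := by
  simp [simpleCoroot]

theorem simpleCoroot_single_self (i : B) :
    simpleCoroot M i (Finsupp.single i 1) = 2 := by
  simp [simpleCoroot_single]

/-- The action of a simple reflection in the geometric representation. -/
noncomputable def geometricReflection (i : B) : (B →₀ ℝ) ≃ₗ[ℝ] (B →₀ ℝ) :=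
  reflection (simpleCoroot_single_self M i)

variable {M}

theorem simpleCoroot_mul_simpleCoroot_sub_two (i j : B) :
    simpleCoroot M i (Finsupp.single j 1) * simpleCoroot M j (Finsupp.single i 1) - 2 =
      2 * Real.cos (2 * (Real.pi / M i j)) := by
  rw [simpleCoroot_single, simpleCoroot_single, M.symmetric j i, Real.cos_two_mul]
  ring

theorem sin_two_mul_pi_div_pos {m : ℕ} (hm : 3 ≤ m) : 0 < Real.sin (2 * (Real.pi / m)) := by
  have hm' : (3 : ℝ) ≤ m := by exact_mod_cast hm
  have hπ := Real.pi_pos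
  refine Real.sin_pos_of_pos_of_lt_pi (by positivity) ?_
  rw [← mul_div_assoc, div_lt_iff₀ (by positivity)]
  nlinarith

theorem geometricReflection_isLiftable : M.IsLiftable (geometricReflection M) := by
  intro i j
  obtain rfl | hij := eq_or_ne i j
  · rw [M.diagonal, pow_one]
    exact LinearEquiv.ext (involutive_reflection (simpleCoroot_single_self M i))
  have h1 := M.off_diagonal i j hij
  obtain h | h | h : M i j = 0 ∨ M i j = 2 ∨ 3 ≤ M i j := by omega
  · rw [h, pow_zero]
  · have hi : simpleCoroot M i (Finsupp.single j 1) = 0 := by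
      simp [simpleCoroot_single, h]
    have hj : simpleCoroot M j (Finsupp.single i 1) = 0 := by
      simp [simpleCoroot_single, M.symmetric j i, h]
    rw [h, pow_two]
    refine LinearEquiv.ext fun v ↦ ?_
    simp only [geometricReflection, LinearEquiv.mul_apply, reflection_apply, map_sub, map_smul,
      hi, hj, simpleCoroot_single_self, LinearEquiv.coe_one, id_eq]
    module
  · refine LinearEquiv.ext fun v ↦ ?_
    have hS := S_two_mul_real_cos (2 * (Real.pi / M i j))
    have hs := (sin_two_mul_pi_div_pos h).ne'
    have hmθ : (M i j : ℝ) * (Real.pi / M i j) = Real.pi := by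
      field_simp
    rw [geometricReflection, geometricReflection, reflection_mul_reflection_pow_apply _ _ _ _ _
      (simpleCoroot_mul_simpleCoroot_sub_two i j).symm]
    generalize Real.pi / M i j = θ at hS hs hmθ ⊢
    obtain ⟨k, hk⟩ := Nat.even_or_odd' (M i j)
    generalize M i j = m at *
    obtain rfl | rfl := hk
    · have e : ((((2 * k : ℕ) : ℤ) - 2) / 2 = k - 1) ∧ ((((2 * k : ℕ) : ℤ) - 1) / 2 = k - 1) := by
        omega
      have h0 : (S ℝ ((k : ℤ) - 1)).eval (2 * Real.cos (2 * θ)) = 0 := by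
        refine (mul_eq_zero.1 ((hS _).trans ?_)).resolve_right hs
        push_cast at hmθ ⊢
        rw [← Real.sin_pi, ← hmθ]
        ring_nf
      rw [e.1, e.2, h0]
      simp
    · have e : ((((2 * k + 1 : ℕ) : ℤ) - 2) / 2 = k - 1) ∧
          ((((2 * k + 1 : ℕ) : ℤ) - 1) / 2 = k) ∧
          ((((2 * k + 1 : ℕ) : ℤ) - 3) / 2 = k - 1) ∧ (((2 * k + 1 : ℕ) : ℤ) / 2 = k) := by
        omega
      have h0 : (S ℝ (k : ℤ)).eval (2 * Real.cos (2 * θ)) +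
          (S ℝ ((k : ℤ) - 1)).eval (2 * Real.cos (2 * θ)) = 0 := by
        refine (mul_eq_zero.1 ?_).resolve_right hs
        rw [add_mul, hS, hS]
        push_cast at hmθ ⊢
        have h₁ : ((k : ℝ) + 1) * (2 * θ) = Real.pi + θ := by linear_combination hmθ
        have h₂ : ((k : ℝ) - 1 + 1) * (2 * θ) = Real.pi - θ := by linear_combination hmθ
        rw [h₁, h₂, Real.sin_pi_sub, add_comm Real.pi, Real.sin_add_pi]
        ring
      rw [e.1, e.2.1, e.2.2.1, e.2.2.2, h0]
      simp

theorem geometricReflection_mul_pow_ne_one {i j : B} (hij : i ≠ j) {k : ℕ} (hk : 0 < k)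
    (hkM : M i j = 0 ∨ k < M i j) :
    (geometricReflection M i * geometricReflection M j) ^ k ≠ 1 := by
  intro h
  have h1 := M.off_diagonal i j hij
  have hv := congrArg (fun φ ↦ φ (Finsupp.single i (1 : ℝ))) h
  simp only [geometricReflection] at hv
  rw [reflection_mul_reflection_pow_apply_self _ _ _ _
    (simpleCoroot_mul_simpleCoroot_sub_two i j).symm] at hv
  have hi := congrArg (fun v : B →₀ ℝ ↦ v i) hv
  have hj := congrArg (fun v : B →₀ ℝ ↦ v j) hv
  simp only [Finsupp.add_apply, Finsupp.smul_apply, Finsupp.single_eq_same, smul_eq_mul,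
    Finsupp.single_eq_of_ne hij, Finsupp.single_eq_of_ne hij.symm, LinearEquiv.coe_one, id_eq,
    mul_one, mul_zero, add_zero, zero_add, simpleCoroot_single, M.symmetric j i] at hi hj
  obtain h' | h' | h' : M i j = 0 ∨ M i j = 2 ∨ 3 ≤ M i j := by omega
  · simp [h', S_eval_two] at hj
    omega
  · obtain rfl : k = 1 := by omega
    have hc : Real.cos (2 * (Real.pi / 2)) = -1 := by
      rw [mul_div_cancel₀ _ two_ne_zero, Real.cos_pi]
    simp [h', hc] at hi
  · have hS := S_two_mul_real_cos (2 * (Real.pi / M i j))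
    have hs := (sin_two_mul_pi_div_pos h').ne'
    have hkm : (k : ℝ) < M i j := by exact_mod_cast hkM.resolve_left (by omega)
    have hk' : (0 : ℝ) < k := by exact_mod_cast hk
    have hπ := Real.pi_pos
    have hmθ : (M i j : ℝ) * (Real.pi / M i j) = Real.pi := by
      field_simp
    have hθ : 0 < Real.pi / M i j := div_pos hπ (hk'.trans hkm)
    have hc : Real.cos (Real.pi / M i j) ≠ 0 := by
      intro hc
      rw [Real.sin_two_mul, hc, mul_zero] at hs
      exact hs rfl
    generalize Real.pi / M i j = θ at *
    have h0 : (S ℝ ((k : ℤ) - 1)).eval (2 * Real.cos (2 * θ)) = 0 := by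
      simpa [hc] using hj
    have h1 : (S ℝ (k : ℤ)).eval (2 * Real.cos (2 * θ)) = 1 := by
      simpa [h0] using hi
    have hS0 := hS ((k : ℤ) - 1)
    have hS1 := hS (k : ℤ)
    rw [h0, zero_mul] at hS0
    rw [h1, one_mul] at hS1
    push_cast at hS0 hS1
    rw [sub_add_cancel] at hS0
    rw [add_mul, Real.sin_add, ← hS0, one_mul, zero_mul, zero_add] at hS1
    have hcos : Real.cos (k * (2 * θ)) = 1 := mul_right_cancel₀ hs (by rw [← hS1, one_mul])
    have := (Real.cos_eq_one_iff_of_lt_of_lt (by nlinarith [mul_pos hk' hθ])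
      (by nlinarith [mul_lt_mul_of_pos_right hkm hθ])).1 hcos
    nlinarith [mul_pos hk' hθ]

end Geometric

variable {B W : Type*} [Group W] {M : CoxeterMatrix B} (cs : CoxeterSystem M W)

theorem simple_mul_simple_pow_ne_one {i j : B} (hij : i ≠ j) {k : ℕ} (hk : 0 < k)
    (hkM : M i j = 0 ∨ k < M i j) : (cs.simple i * cs.simple j) ^ k ≠ 1 := by
  intro h
  have := congrArg (cs.lift ⟨_, geometricReflection_isLiftable⟩) h
  rw [map_pow, map_mul, lift_apply_simple, lift_apply_simple, map_one] at this
  exact geometricReflection_mul_pow_ne_one hij hk hkM this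

/-! ### The exchange property -/

theorem rightInvSeq_alternatingWord (i j : B) (n : ℕ) :
    cs.rightInvSeq (alternatingWord i j n) =
      ((List.range n).map fun k ↦ (cs.simple j * cs.simple i) ^ k * cs.simple j).reverse := by
  induction n generalizing i j with
  | zero => rfl
  | succ n ih =>
    rw [alternatingWord_succ, rightInvSeq_concat, ih, List.range_succ_eq_map]
    simp only [List.map_cons, pow_zero, one_mul, List.map_map, List.reverse_cons,
      List.concat_eq_append, List.map_reverse]
    congr 3
    funext k
    simp only [Function.comp_apply, MulAut.conj_apply, inv_simple, Nat.succ_eq_add_one]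
    have hsemi : SemiconjBy (cs.simple i) (cs.simple j * cs.simple i)
        (cs.simple i * cs.simple j) := (mul_assoc _ _ _).symm
    rw [← (hsemi.pow_right k).eq, pow_succ', mul_assoc (cs.simple j) (cs.simple i)]

open Classical in
/-- The action of a simple reflection on pairs of a group element and a sign, which flips the sign
exactly at that reflection. -/
noncomputable def signedConj (i : B) : Function.End (W × ZMod 2) := fun p ↦
  (cs.simple i * p.1 * cs.simple i, p.2 + if p.1 = cs.simple i then 1 else 0)

open Classical in
theorem prod_map_signedConj_apply (ω : List B) (p : W × ZMod 2) :
    (ω.map cs.signedConj).prod p =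
      (cs.wordProd ω * p.1 * (cs.wordProd ω)⁻¹, p.2 + ((cs.rightInvSeq ω).count p.1 : ℕ)) := by
  induction ω with
  | nil => simp [Function.End.one_def]
  | cons i ω ih =>
    rw [List.map_cons, List.prod_cons]
    change cs.signedConj i ((ω.map cs.signedConj).prod p) = _
    rw [ih]
    have key : cs.wordProd ω * p.1 * (cs.wordProd ω)⁻¹ = cs.simple i ↔
        (cs.wordProd ω)⁻¹ * cs.simple i * cs.wordProd ω = p.1 := by
      constructor
      · intro h
        rw [← h]
        group
      · intro h
        rw [← h]
        group
    simp only [signedConj, rightInvSeq, wordProd_cons, List.count_cons, key, beq_iff_eq,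
      mul_inv_rev, inv_simple, Nat.cast_add, Nat.cast_ite, Nat.cast_one, Nat.cast_zero, add_assoc]
    simp only [mul_assoc]

theorem prod_map_alternatingWord_two_mul {G : Type*} [Monoid G] (f : B → G) (i j : B) (m : ℕ) :
    ((alternatingWord i j (2 * m)).map f).prod = (f i * f j) ^ m := by
  induction m with
  | zero => simp [alternatingWord]
  | succ m ih =>
    rw [mul_add, mul_one, alternatingWord_succ, alternatingWord_succ]
    simp [ih, pow_succ]

theorem signedConj_isLiftable : M.IsLiftable cs.signedConj := by
  classical
  intro i j
  rw [← prod_map_alternatingWord_two_mul]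
  funext p
  rw [prod_map_signedConj_apply]
  have hπ : cs.wordProd (alternatingWord i j (2 * M i j)) = 1 := by
    rw [wordProd, prod_map_alternatingWord_two_mul, simple_mul_simple_pow]
  have hcount : ((cs.rightInvSeq (alternatingWord i j (2 * M i j))).count p.1 : ZMod 2) = 0 := by
    rw [rightInvSeq_alternatingWord, List.count_reverse, two_mul, List.range_add, List.map_append,
      List.map_map, List.count_append]
    have : ((fun k ↦ (cs.simple j * cs.simple i) ^ k * cs.simple j) ∘ fun x ↦ M i j + x) =
        fun k ↦ (cs.simple j * cs.simple i) ^ k * cs.simple j := by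
      funext k
      simp [pow_add]
    rw [this]
    push_cast
    exact CharTwo.add_self_eq_zero _
  rw [hπ, hcount]
  simp [Function.End.one_def]

open Classical in
theorem count_rightInvSeq_eq_of_wordProd_eq {ω ω' : List B}
    (h : cs.wordProd ω = cs.wordProd ω') (t : W) :
    ((cs.rightInvSeq ω).count t : ZMod 2) = (cs.rightInvSeq ω').count t := by
  have key (τ : List B) : cs.lift ⟨_, cs.signedConj_isLiftable⟩ (cs.wordProd τ) =
      (τ.map cs.signedConj).prod := by
    rw [wordProd, map_list_prod, List.map_map]
    congr 2
    funext i
    exact cs.lift_apply_simple _ i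
  have := congrArg (fun φ : Function.End (W × ZMod 2) ↦ (φ (t, 0)).2)
    ((key ω).symm.trans ((congrArg _ h).trans (key ω')))
  simpa [prod_map_signedConj_apply] using this

/-- The exchange property: a right descent of `π ω` occurs in the right inversion sequence of
`ω`. -/
theorem IsRightDescent.simple_mem_rightInvSeq {ω : List B} {i : B}
    (h : cs.IsRightDescent (cs.wordProd ω) i) : cs.simple i ∈ cs.rightInvSeq ω := by
  classical
  obtain ⟨u, hu, huω⟩ := cs.exists_isReduced (cs.wordProd ω * cs.simple i)
  have hprod : cs.wordProd (u.concat i) = cs.wordProd ω := by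
    rw [wordProd_concat, ← huω, simple_mul_simple_cancel_right]
  have hred : cs.IsReduced (u.concat i) := by
    rw [IsReduced, hprod, ← cs.isRightDescent_iff.1 h, huω, hu.eq, List.length_concat]
  have hmem : cs.simple i ∈ cs.rightInvSeq (u.concat i) := by
    rw [rightInvSeq_concat]
    simp
  have hcount := cs.count_rightInvSeq_eq_of_wordProd_eq hprod (cs.simple i)
  rw [List.count_eq_one_of_mem hred.nodup_rightInvSeq hmem] at hcount
  by_contra hnot
  rw [List.count_eq_zero_of_not_mem hnot] at hcount
  simp at hcount

theorem IsRightDescent.exists_wordProd_mul_simple_eq {ω : List B} {i : B}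
    (h : cs.IsRightDescent (cs.wordProd ω) i) :
    ∃ k < ω.length, cs.wordProd ω * cs.simple i = cs.wordProd (ω.eraseIdx k) := by
  obtain ⟨k, hk, hki⟩ := List.mem_iff_getElem.1 (h.simple_mem_rightInvSeq cs)
  refine ⟨k, by simpa using hk, ?_⟩
  rw [← wordProd_mul_getD_rightInvSeq, List.getD_eq_getElem _ 1 hk, hki]

/-! ### Reduced words with a prescribed alternating end -/

theorem isReduced_alternatingWord {i j : B} (hij : i ≠ j) {n : ℕ}
    (hn : M i j = 0 ∨ n ≤ M i j) : cs.IsReduced (alternatingWord i j n) := by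
  induction n generalizing i j with
  | zero => simp [alternatingWord, IsReduced]
  | succ n ih =>
    have hred := ih hij.symm (by rw [M.symmetric j i]; omega)
    by_contra hnot
    have hdesc : cs.IsRightDescent (cs.wordProd (alternatingWord j i n)) j := by
      by_contra hd
      rw [not_isRightDescent_iff, ← wordProd_concat, hred.eq, ← List.length_concat] at hd
      exact hnot hd
    have hmem := hdesc.simple_mem_rightInvSeq cs
    rw [rightInvSeq_alternatingWord, List.mem_reverse, List.mem_map] at hmem
    obtain ⟨k, hk, hkj⟩ := hmem
    rw [List.mem_range] at hk
    refine cs.simple_mul_simple_pow_ne_one hij k.succ_pos (by omega) ?_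
    rw [pow_succ, ← mul_assoc, hkj, simple_mul_simple_self]

theorem exists_isReduced_append_alternatingWord {w : W} {i j : B} (hij : i ≠ j)
    (hi : cs.IsRightDescent w i) (hj : cs.IsRightDescent w j) {n : ℕ}
    (hn : M i j = 0 ∨ n ≤ M i j) :
    ∃ ω : List B, cs.IsReduced (ω ++ alternatingWord i j n) ∧
      cs.wordProd (ω ++ alternatingWord i j n) = w := by
  induction n generalizing i j with
  | zero =>
    obtain ⟨ω, hω, rfl⟩ := cs.exists_isReduced w
    exact ⟨ω, by simpa [alternatingWord] using hω, by simp [alternatingWord]⟩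
  | succ n ih =>
    obtain ⟨ω, hω, rfl⟩ := ih hij.symm hj hi (by rw [M.symmetric j i]; omega)
    obtain ⟨k, hk, hprod⟩ := hj.exists_wordProd_mul_simple_eq cs
    obtain hlt | hle := lt_or_ge k ω.length
    · rw [List.eraseIdx_append_of_lt_length hlt] at hprod
      have heq : cs.wordProd (ω.eraseIdx k ++ alternatingWord i j (n + 1)) =
          cs.wordProd (ω ++ alternatingWord j i n) := by
        rw [alternatingWord_succ, List.concat_eq_append, ← List.append_assoc, wordProd_append,
          ← hprod, wordProd_singleton, simple_mul_simple_cancel_right]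
      refine ⟨ω.eraseIdx k, ?_, heq⟩
      rw [IsReduced, heq, hω.eq]
      have := List.length_eraseIdx_add_one hlt
      simp only [List.length_append, length_alternatingWord]
      omega
    · rw [List.eraseIdx_append_of_length_le hle, wordProd_append, wordProd_append, mul_assoc,
        mul_right_inj, ← wordProd_concat, ← alternatingWord_succ] at hprod
      have hred := (cs.isReduced_alternatingWord hij hn).eq
      have hlen := cs.length_wordProd_le ((alternatingWord j i n).eraseIdx (k - ω.length))
      have := List.length_eraseIdx_le (alternatingWord j i n) (k - ω.length)
      rw [← hprod, hred] at hlen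
      simp only [length_alternatingWord] at hlen this
      omega

theorem ne_zero_of_isRightDescent {w : W} {i j : B} (hij : i ≠ j)
    (hi : cs.IsRightDescent w i) (hj : cs.IsRightDescent w j) : M i j ≠ 0 := by
  intro h0
  obtain ⟨ω, hω, hωw⟩ := cs.exists_isReduced_append_alternatingWord hij hi hj
    (n := cs.length w + 1) (Or.inl h0)
  have := hω.eq
  rw [hωw] at this
  simp only [List.length_append, length_alternatingWord] at this
  omega

theorem IsReduced.isRightDescent_of_append_singleton {cs : CoxeterSystem M W} {ω : List B} {i : B}
    (h : cs.IsReduced (ω ++ [i])) : cs.IsRightDescent (cs.wordProd (ω ++ [i])) i := by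
  rw [IsRightDescent, h.eq, wordProd_append, wordProd_singleton, simple_mul_simple_cancel_right,
    List.length_append]
  exact (cs.length_wordProd_le ω).trans_lt (by simp)

theorem IsReduced.of_append_left {cs : CoxeterSystem M W} {ω ω' : List B}
    (h : cs.IsReduced (ω ++ ω')) : cs.IsReduced ω := by
  simpa using h.take ω.length

/-! ### Commutation classes -/

theorem commutationMoveRel_append_right {ω ω' : List B} (τ : List B)
    (h : Relation.ReflTransGen (CommutationMoveRel M) ω ω') :
    Relation.ReflTransGen (CommutationMoveRel M) (ω ++ τ) (ω' ++ τ) := by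
  refine Relation.ReflTransGen.lift (· ++ τ) ?_ _ _ h
  rintro _ _ ⟨i, j, l₁, l₂, hM, rfl, rfl⟩
  exact ⟨i, j, l₁, l₂ ++ τ, hM, by simp, by simp⟩

theorem reflTransGen_commutationMoveRel_of_no_long_braid {ω ω' : List B}
    (hω : cs.IsReduced ω) (hω' : cs.IsReduced ω') (heq : cs.wordProd ω' = cs.wordProd ω)
    (hbraid : ∀ τ : List B, cs.IsReduced τ → cs.wordProd τ = cs.wordProd ω →
      ∀ i j : B, 3 ≤ M i j → ¬ (alternatingWord i j (M i j)).IsInfix τ) :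
    Relation.ReflTransGen (CommutationMoveRel M) ω ω' := by
  induction hn : ω.length generalizing ω ω' with
  | zero =>
    have hn' : ω'.length = 0 := by rw [← hω'.eq, heq, hω.eq, hn]
    rw [List.length_eq_zero_iff] at hn hn'
    rw [hn, hn']
  | succ n ih =>
    have hn' : ω'.length = n + 1 := by rw [← hω'.eq, heq, hω.eq, hn]
    have of_common_last (u v : List B) (i : B) (hlen : u.length = n) (hu : cs.IsReduced (u ++ [i]))
        (hv : cs.IsReduced (v ++ [i])) (huω : cs.wordProd (u ++ [i]) = cs.wordProd ω)
        (hvω : cs.wordProd (v ++ [i]) = cs.wordProd ω) :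
        Relation.ReflTransGen (CommutationMoveRel M) (u ++ [i]) (v ++ [i]) := by
      have huv : cs.wordProd v = cs.wordProd u := by
        have := hvω.trans huω.symm
        rwa [wordProd_append, wordProd_append, mul_left_inj] at this
      refine commutationMoveRel_append_right _
        (ih hu.of_append_left hv.of_append_left huv ?_ hlen)
      intro τ hτ hτu a b hab hinf
      have hτω : cs.wordProd (τ ++ [i]) = cs.wordProd ω := by
        rw [← huω, wordProd_append, hτu, wordProd_append]
      refine hbraid (τ ++ [i]) ?_ hτω a b hab (hinf.trans (List.infix_append' [] τ [i]))
      rw [IsReduced, hτω, hω.eq, hn, List.length_append, ← hτ.eq, hτu,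
        hu.of_append_left.eq, hlen, List.length_singleton]
    obtain rfl | ⟨u, i, rfl⟩ := List.eq_nil_or_concat' ω
    · simp at hn
    obtain rfl | ⟨v, j, rfl⟩ := List.eq_nil_or_concat' ω'
    · simp at hn'
    simp only [List.length_append, List.length_singleton, Nat.add_right_cancel_iff] at hn hn'
    obtain rfl | hij := eq_or_ne i j
    · exact of_common_last u v i hn hω hω' rfl heq
    have hi := hω.isRightDescent_of_append_singleton
    have hj := hω'.isRightDescent_of_append_singleton
    rw [heq] at hj
    have h0 := cs.ne_zero_of_isRightDescent hij hi hj
    have h1 := M.off_diagonal i j hij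
    obtain ⟨x, hx, hxω⟩ := cs.exists_isReduced_append_alternatingWord hij hi hj (Or.inr le_rfl)
    obtain h | h : M i j = 2 ∨ 3 ≤ M i j := by omega
    · have hM' := M.symmetric i j
      have hbr := cs.wordProd_braidWord_eq i j
      have hword (a b : B) : x ++ alternatingWord a b 2 = (x ++ [a]) ++ [b] := by
        simp [alternatingWord]
      rw [braidWord, braidWord, ← hM', h] at hbr
      rw [h] at hx hxω
      have hxω' : cs.wordProd (x ++ alternatingWord j i 2) = cs.wordProd (u ++ [i]) := by
        rw [wordProd_append, ← hbr, ← wordProd_append, hxω]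
      have hx' : cs.IsReduced (x ++ alternatingWord j i 2) := by
        rw [IsReduced, hxω', ← hxω, hx.eq]
        simp
      have hlen : x.length + 2 = n + 1 := by
        rw [← hn, ← List.length_singleton (a := i), ← List.length_append, ← hω.eq, ← hxω, hx.eq]
        simp
      rw [hword] at hx hxω hx' hxω'
      refine (of_common_last u (x ++ [j]) i hn hω hx' rfl hxω').trans (.head ?_
        (of_common_last (x ++ [i]) v j (by simp; omega) hx hω' hxω heq))
      exact ⟨j, i, x, [], by rw [← hM', h], by simp, by simp⟩
    · exact (hbraid _ hx hxω i j h (List.suffix_append x _).isInfix).elim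

open Classical in
theorem filter_eq_of_reflTransGen_commutationMoveRel {i j : B} (hij : M i j ≠ 2) {ω ω' : List B}
    (h : Relation.ReflTransGen (CommutationMoveRel M) ω ω') :
    ω.filter (fun a ↦ a = i ∨ a = j) = ω'.filter (fun a ↦ a = i ∨ a = j) := by
  induction h with
  | refl => rfl
  | tail _ hmove ih =>
    rw [ih]
    obtain ⟨a, b, l₁, l₂, hM, rfl, rfl⟩ := hmove
    have hab : ¬ ((a = i ∨ a = j) ∧ (b = i ∨ b = j)) := by
      rintro ⟨rfl | rfl, rfl | rfl⟩
      · simp at hM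
      · exact hij hM
      · exact hij (M.symmetric _ _ ▸ hM)
      · simp at hM
    by_cases ha : a = i ∨ a = j <;> by_cases hb : b = i ∨ b = j <;>
      simp_all [List.filter_append]

theorem eq_or_eq_of_mem_alternatingWord {i j a : B} {n : ℕ} (h : a ∈ alternatingWord i j n) :
    a = i ∨ a = j := by
  induction n generalizing i j with
  | zero => simp [alternatingWord] at h
  | succ n ih =>
    rw [alternatingWord_succ, List.concat_eq_append, List.mem_append, List.mem_singleton] at h
    exact h.elim (fun h ↦ (ih h).symm) Or.inr

end CoxeterSystem

/-- **Stembridge's criterion.** An element `w` is fully commutative if and only if no reduced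
word for `w` contains the alternating word `i, j, i, j, …` of length `M i j` as a contiguous
subword, for any pair `i, j` with `M i j ≥ 3`. -/
theorem isFullyCommutative_iff {B : Type*} {W : Type*} [Group W] {M : CoxeterMatrix B}
    (cs : CoxeterSystem M W) (w : W) :
    IsFullyCommutative cs w ↔
      ∀ ω : List B, cs.IsReduced ω → cs.wordProd ω = w →
        ∀ i j : B, 3 ≤ M i j →
          ¬ (CoxeterSystem.alternatingWord i j (M i j)).IsInfix ω := by
  classical
  constructor
  · rintro hw _ hred hprod i j hM ⟨s, t, rfl⟩
    have heq : cs.wordProd (s ++ CoxeterSystem.alternatingWord j i (M i j) ++ t) =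
        cs.wordProd (s ++ CoxeterSystem.alternatingWord i j (M i j) ++ t) := by
      have := cs.wordProd_braidWord_eq i j
      rw [CoxeterSystem.braidWord, CoxeterSystem.braidWord, M.symmetric j i] at this
      simp only [cs.wordProd_append, this]
    have hred' : cs.IsReduced (s ++ CoxeterSystem.alternatingWord j i (M i j) ++ t) := by
      rw [CoxeterSystem.IsReduced, heq, hred.eq]
      simp
    have hfilter := CoxeterSystem.filter_eq_of_reflTransGen_commutationMoveRel
      (i := i) (j := j) (by omega) (hw _ _ hred hred' hprod (heq.trans hprod))
    have hij : (CoxeterSystem.alternatingWord i j (M i j)).filter (fun a ↦ a = i ∨ a = j) =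
        CoxeterSystem.alternatingWord i j (M i j) :=
      List.filter_eq_self.2 fun a ha ↦ by
        simpa using CoxeterSystem.eq_or_eq_of_mem_alternatingWord ha
    have hji : (CoxeterSystem.alternatingWord j i (M i j)).filter (fun a ↦ a = i ∨ a = j) =
        CoxeterSystem.alternatingWord j i (M i j) :=
      List.filter_eq_self.2 fun a ha ↦ by
        simpa using (CoxeterSystem.eq_or_eq_of_mem_alternatingWord ha).symm
    rw [List.filter_append, List.filter_append, List.filter_append, List.filter_append, hij, hji,
      List.append_left_inj, List.append_right_inj] at hfilter
    obtain ⟨n, hn⟩ : ∃ n, M i j = n + 1 := ⟨M i j - 1, by omega⟩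
    rw [hn, CoxeterSystem.alternatingWord_succ, CoxeterSystem.alternatingWord_succ,
      List.concat_eq_append, List.concat_eq_append] at hfilter
    obtain rfl : j = i := by simpa using (List.append_inj' hfilter rfl).2
    simp at hM
  · rintro hbraid ω ω' hω hω' rfl hprod
    exact cs.reflTransGen_commutationMoveRel_of_no_long_braid hω hω' hprod hbraid
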